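/- arXiv:1809.01853 — 3 statements merged into one kernel-verified Lean document; each statement's English description precedes it below -/
import Mathlib

section
/- Let (i_1,…,i_k) be a strictly increasing tuple of nonnegative integers, σ ∈ Σ_k a permutation of its positions, and 1 ≤ m ≤ k−1. Then the two blocks (σ(i_1),…,σ(i_m)) and (σ(i_{m+1}),…,σ(i_k)) are both strictly increasing if and only if the two hatted blocks (ĥσ(i_1),…,ĥσ(i_m)) and (ĥσ(i_{m+1}),…,ĥσ(i_k)) are both strictly increasing. -/
/-- `alphaC i σ s` is the number of indices `t > s` such that the entry of the permuted
tuple at position `t` is smaller than the entry at position `s`, i.e. `α(σ(i_s))`. -/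
def alphaC {k : ℕ} (i : Fin k → ℕ) (σ : Equiv.Perm (Fin k)) (s : Fin k) : ℕ :=
  (Finset.univ.filter fun t => s < t ∧ i (σ t) < i (σ s)).card

/-- The hatted entry `ĥσ(i_s) = σ(i_s) − α(σ(i_s))`. -/
def hatC {k : ℕ} (i : Fin k → ℕ) (σ : Equiv.Perm (Fin k)) (s : Fin k) : ℕ :=
  i (σ s) - alphaC i σ s

theorem Fin.strictMono_iff_lt_next {n : ℕ} (f : Fin n → ℕ) :
    StrictMono f ↔ ∀ (j : ℕ) (h : j + 1 < n), f ⟨j, by omega⟩ < f ⟨j + 1, h⟩ := by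
  cases n with
  | zero => exact ⟨fun _ j h => absurd h (by omega), fun _ x => x.elim0⟩
  | succ n =>
    rw [Fin.strictMono_iff_lt_succ]
    exact ⟨fun H j h => H ⟨j, by omega⟩, fun H x => H x.1 (by omega)⟩

theorem card_filter_mem_Ico_le {k : ℕ} {a : Fin k → ℕ} (ha : Function.Injective a)
    (p q : ℕ) : (Finset.univ.filter fun t => p ≤ a t ∧ a t < q).card ≤ q - p := by
  rw [← Nat.card_Ico]
  exact Finset.card_le_card_of_injOn a (fun t ht => by simpa using ht) ha.injOn

theorem alphaC_le {k : ℕ} {i : Fin k → ℕ} (hi : StrictMono i) (σ : Equiv.Perm (Fin k))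
    (s : Fin k) : alphaC i σ s ≤ i (σ s) := by
  refine le_trans (Finset.card_le_card ?_)
    (card_filter_mem_Ico_le (hi.injective.comp σ.injective) 0 (i (σ s)))
  intro t ht
  simp_all

/-- The hat preserves strict increase between any two positions. -/
theorem hatC_lt_of_lt {k : ℕ} {i : Fin k → ℕ} (hi : StrictMono i) (σ : Equiv.Perm (Fin k))
    {s t : Fin k} (hst : s < t) (h : i (σ s) < i (σ t)) : hatC i σ s < hatC i σ t := by
  have hinj := hi.injective.comp σ.injective
  have key : alphaC i σ t ≤ alphaC i σ s + (i (σ t) - (i (σ s) + 1)) := by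
    refine le_trans (le_trans (Finset.card_le_card ?_) (Finset.card_union_le _ _))
      (Nat.add_le_add_left (card_filter_mem_Ico_le hinj (i (σ s) + 1) (i (σ t))) _)
    intro u hu
    simp only [Finset.mem_filter, Finset.mem_univ, true_and, Finset.mem_union,
      Function.comp_apply] at hu ⊢
    have hne : i (σ u) ≠ i (σ s) := fun e => (hst.trans hu.1).ne' (hinj e)
    have hsu := hst.trans hu.1
    rcases hne.lt_or_gt with hlt | hgt
    · exact Or.inl ⟨hsu, hlt⟩
    · exact Or.inr ⟨hgt, hu.2⟩
  have := alphaC_le hi σ s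
  have := alphaC_le hi σ t
  unfold hatC
  omega

/-- The hat preserves weak decrease between consecutive positions. -/
theorem hatC_le_of_le {k : ℕ} {i : Fin k → ℕ} (hi : StrictMono i) (σ : Equiv.Perm (Fin k))
    {s t : Fin k} (hst : s.1 + 1 = t.1) (h : i (σ t) ≤ i (σ s)) :
    hatC i σ t ≤ hatC i σ s := by
  have hinj := hi.injective.comp σ.injective
  have key : alphaC i σ s ≤ alphaC i σ t + (i (σ s) - i (σ t)) := by
    refine le_trans (le_trans (Finset.card_le_card ?_) (Finset.card_union_le _ _))
      (Nat.add_le_add_left (card_filter_mem_Ico_le hinj (i (σ t)) (i (σ s))) _)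
    intro u hu
    simp only [Finset.mem_filter, Finset.mem_univ, true_and, Finset.mem_union,
      Function.comp_apply] at hu ⊢
    rcases lt_or_ge (i (σ u)) (i (σ t)) with hlt | hge
    · have hne : u ≠ t := by rintro rfl; exact lt_irrefl _ hlt
      exact Or.inl ⟨by have := hu.1; omega, hlt⟩
    · exact Or.inr ⟨hge, hu.2⟩
  have := alphaC_le hi σ s
  have := alphaC_le hi σ t
  unfold hatC
  omega

theorem lt_iff_hatC_lt {k : ℕ} {i : Fin k → ℕ} (hi : StrictMono i) (σ : Equiv.Perm (Fin k))
    {s t : Fin k} (hst : s.1 + 1 = t.1) :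
    i (σ s) < i (σ t) ↔ hatC i σ s < hatC i σ t :=
  ⟨hatC_lt_of_lt hi σ (Fin.lt_def.2 (by omega)),
    fun h => lt_of_not_ge fun hle => (hatC_le_of_le hi σ hst hle).not_gt h⟩

/-- Proposition 2.1. For a strictly increasing tuple `(i_1,…,i_k)` of
nonnegative integers, a permutation `σ ∈ Σ_k` of its positions and `1 ≤ m ≤ k−1`, the two
blocks `(σ(i_1),…,σ(i_m))` and `(σ(i_{m+1}),…,σ(i_k))` are both strictly increasing if and
only if the two hatted blocks `(ĥσ(i_1),…,ĥσ(i_m))` and `(ĥσ(i_{m+1}),…,ĥσ(i_k))` are both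
strictly increasing. -/
theorem partition_ordered_iff_hatted_ordered {k : ℕ} (i : Fin k → ℕ) (hi : StrictMono i)
    (σ : Equiv.Perm (Fin k)) (m : ℕ) (hm1 : 1 ≤ m) (hm2 : m ≤ k - 1) :
    ((StrictMono fun s : Fin m => i (σ (Fin.castLE (by omega) s))) ∧
      (StrictMono fun s : Fin (k - m) => i (σ ⟨m + s.1, by omega⟩)))
      ↔
    ((StrictMono fun s : Fin m => hatC i σ (Fin.castLE (by omega) s)) ∧
      (StrictMono fun s : Fin (k - m) => hatC i σ ⟨m + s.1, by omega⟩)) := by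
  simp only [Fin.strictMono_iff_lt_next]
  exact and_congr
    (forall₂_congr fun _ _ => lt_iff_hatC_lt hi σ rfl)
    (forall₂_congr fun _ _ => lt_iff_hatC_lt hi σ rfl)
end

section
/- Let (X,d,∂̃) be a differential module with ∞-simplicial faces over a commutative ring K. Define maps d^k : X_{n,q} → X_{n−k,q+k−1} for k ≥ 0 by: d^0 = d; d^k = 0 for k > n; and d^k = Σ_{0 ≤ i_1 < … < i_k ≤ n} (−1)^{i_1+…+i_k} ∂_{(i_1,…,i_k)} for 1 ≤ k ≤ n. Then for every k ≥ 0 the relation Σ_{i+j=k} d^i ∘ d^j = 0 holds; that is, (X,{d^k}) is a D∞-module. -/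
open scoped Classical

/-- Transport of a component of a bigraded module along equalities of the indices. -/
def gcast {K : Type} [CommRing K] {X : ℕ → ℤ → Type} [∀ n q, AddCommGroup (X n q)]
    [∀ n q, Module K (X n q)] {n n' : ℕ} {q q' : ℤ} (hn : n = n') (hq : q = q') :
    X n q →ₗ[K] X n' q' := by
  subst hn; subst hq; exact LinearMap.id

/-- The hatted head block `(ĥσ(i_1),…,ĥσ(i_m))`. -/
def headBlock {k : ℕ} (i : Fin k → ℕ) (σ : Equiv.Perm (Fin k)) (m : ℕ) (hm : m ≤ k) :
    Fin m → ℕ := fun s => hatC i σ (Fin.castLE hm s)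

/-- The hatted tail block `(ĥσ(i_{m+1}),…,ĥσ(i_k))`. -/
def tailBlock {k : ℕ} (i : Fin k → ℕ) (σ : Equiv.Perm (Fin k)) (m : ℕ) :
    Fin (k - m) → ℕ := fun s => hatC i σ ⟨m + s.1, by omega⟩

/-- The relations (2.5) of a structure of ∞-simplicial faces `F` on a differential
bigraded module `(X, d)`. -/
def Rel25 {K : Type} [CommRing K] (X : ℕ → ℤ → Type) [∀ n q, AddCommGroup (X n q)]
    [∀ n q, Module K (X n q)]
    (d : ∀ (n : ℕ) (q : ℤ), X n q →ₗ[K] X n (q - 1))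
    (F : ∀ (k : ℕ), (Fin k → ℕ) → ∀ (n : ℕ) (q : ℤ), X n q →ₗ[K] X (n - k) (q + k - 1)) :
    Prop :=
  ∀ (k : ℕ) (hk : 1 ≤ k) (i : Fin k → ℕ), StrictMono i → ∀ (n : ℕ) (q : ℤ),
    i ⟨k - 1, by omega⟩ ≤ n →
    d (n - k) (q + k - 1) ∘ₗ F k i n q
        + gcast rfl (by ring) ∘ₗ F k i n (q - 1) ∘ₗ d n q
      = ∑ σ : Equiv.Perm (Fin k), ∑ m ∈ (Finset.Icc 1 (k - 1)).attach,
          if StrictMono (headBlock i σ m.1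
                (le_trans (Finset.mem_Icc.mp m.2).2 (Nat.sub_le k 1)))
              ∧ StrictMono (tailBlock i σ m.1) then
            (-(Equiv.Perm.sign σ : ℤ)) •
              (gcast (by have h := Finset.mem_Icc.mp m.2; omega)
                  (by have h := Finset.mem_Icc.mp m.2; omega) ∘ₗ
                F m.1 (headBlock i σ m.1
                    (le_trans (Finset.mem_Icc.mp m.2).2 (Nat.sub_le k 1)))
                  (n - (k - m.1)) (q + (k - m.1 : ℕ) - 1) ∘ₗ
                F (k - m.1) (tailBlock i σ m.1) n q)
          else 0

/-- The maps `d^k` (3.7) associated with a differential module with ∞-simplicial faces: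
`d^0 = d`, `d^k = 0` for `k > n`, and
`d^k = Σ_{0 ≤ i_1<…<i_k ≤ n} (−1)^{i_1+…+i_k} ∂_{(i_1,…,i_k)}` for `1 ≤ k ≤ n`. -/
noncomputable def dkOp {K : Type} [CommRing K] (X : ℕ → ℤ → Type)
    [∀ n q, AddCommGroup (X n q)] [∀ n q, Module K (X n q)]
    (d : ∀ (n : ℕ) (q : ℤ), X n q →ₗ[K] X n (q - 1))
    (F : ∀ (k : ℕ), (Fin k → ℕ) → ∀ (n : ℕ) (q : ℤ), X n q →ₗ[K] X (n - k) (q + k - 1))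
    (k n : ℕ) (q : ℤ) : X n q →ₗ[K] X (n - k) (q + k - 1) :=
  if hk : k = 0 then gcast (by omega) (by rw [hk]; push_cast; ring) ∘ₗ d n q
  else if hkn : n < k then 0
  else
    ∑ i : Fin k → Fin (n + 1),
      if StrictMono (fun s => (i s : ℕ)) then
        ((-1 : ℤ) ^ (∑ s, (i s : ℕ))) • F k (fun s => (i s : ℕ)) n q
      else 0

section HattedBlocks

open Finset

/-- The Lehmer code of a tuple of natural numbers: each entry is lowered by the number of
smaller entries to its right. -/
def lehmerCode {k : ℕ} (f : Fin k → ℕ) (s : Fin k) : ℕ :=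
  f s - #{t | s < t ∧ f t < f s}

lemma hatC_eq_lehmerCode {k : ℕ} (i : Fin k → ℕ) (σ : Equiv.Perm (Fin k)) :
    hatC i σ = lehmerCode (i ∘ σ) := rfl

section LehmerCode

variable {k : ℕ} {f : Fin k → ℕ}

lemma card_smaller_right_le (hf : f.Injective) (s : Fin k) :
    #{t | s < t ∧ f t < f s} ≤ f s := by
  rw [← card_range (f s)]
  refine card_le_card_of_injOn f (fun t ht => ?_) hf.injOn
  simp_all

lemma lehmerCode_add_card (hf : f.Injective) (s : Fin k) :
    lehmerCode f s + #{t | s < t ∧ f t < f s} = f s :=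
  Nat.sub_add_cancel (card_smaller_right_le hf s)

lemma lehmerCode_eq_count (hf : f.Injective) (s : Fin k) :
    lehmerCode f s = Nat.count (fun y => ∀ t, s < t → f t ≠ y) (f s) := by
  have h : #{y ∈ range (f s) | ¬ ∀ t, s < t → f t ≠ y} = #{t | s < t ∧ f t < f s} := by
    rw [← card_image_of_injective {t | s < t ∧ f t < f s} hf]
    congr 1
    ext y
    simp only [mem_filter, mem_range, mem_image, mem_univ, true_and]
    grind
  have h' := card_filter_add_card_filter_not (s := range (f s)) (fun y => ∀ t, s < t → f t ≠ y)
  rw [card_range, h, ← Nat.count_eq_card_filter_range] at h'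
  rw [lehmerCode]
  omega

lemma lehmerCode_injOn : Set.InjOn (lehmerCode (k := k)) {f | f.Injective} := by
  intro f hf g hg h
  have key : ∀ s, f s = g s := by
    intro s
    induction s using WellFoundedGT.induction with
    | ind s ih =>
      have hs := congrFun h s
      have hp : (fun y => ∀ t, s < t → f t ≠ y) = fun y => ∀ t, s < t → g t ≠ y := by
        ext y
        exact forall₂_congr fun t ht => by rw [ih t ht]
      rw [lehmerCode_eq_count hf, lehmerCode_eq_count hg] at hs
      simp only [hp] at hs
      refine Nat.count_injective ?_ ?_ hs
      · exact fun t ht => by rw [← ih t ht]; exact hf.ne ht.ne'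
      · exact fun t ht => hg.ne ht.ne'
  exact funext key

lemma lehmerCode_cons_succ (x : ℕ) (f : Fin k → ℕ) (s : Fin k) :
    lehmerCode (Fin.cons x f : Fin (k + 1) → ℕ) s.succ = lehmerCode f s := by
  simp only [lehmerCode, Fin.cons_succ]
  congr 1
  rw [← card_map (Fin.succEmb k)]
  congr 1
  ext t
  refine Fin.cases ?_ (fun t => ?_) t <;> simp [Fin.succ_ne_zero]

lemma exists_lehmerCode_eq (g : Fin k → ℕ) : ∃ f : Fin k → ℕ, f.Injective ∧ lehmerCode f = g := by
  induction k with
  | zero => exact ⟨g, Function.injective_of_subsingleton _, Subsingleton.elim _ _⟩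
  | succ k ih =>
    obtain ⟨f, hf, hfg⟩ := ih (Fin.tail g)
    have hinf : (Set.ofPred fun y => ∀ t, f t ≠ y).Infinite := by
      convert (Set.finite_range f).infinite_compl using 1
      ext y
      simp
    set x := Nat.nth (fun y => ∀ t, f t ≠ y) (g 0) with hx
    have hxf : ∀ t, f t ≠ x := Nat.nth_mem_of_infinite hinf (g 0)
    have hinj : (Fin.cons x f : Fin (k + 1) → ℕ).Injective :=
      Fin.cons_injective_iff.2 ⟨by simpa using hxf, hf⟩
    refine ⟨Fin.cons x f, hinj, funext fun s => ?_⟩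
    refine Fin.cases ?_ (fun s => ?_) s
    · rw [lehmerCode_eq_count hinj]
      simp only [Fin.cons_zero, Fin.forall_fin_succ, lt_self_iff_false, false_imp_iff, true_and,
        Fin.succ_pos, true_imp_iff, Fin.cons_succ]
      rw [hx, Nat.count_nth_of_infinite hinf]
    · rw [lehmerCode_cons_succ, hfg, Fin.tail]

lemma card_smaller_right_add_card (hf : f.Injective) (s : Fin k) :
    #{t | s < t ∧ f t < f s} + #{t | s < t ∧ f s < f t} = k - 1 - s := by
  rw [← Fin.card_Ioi, ← card_union_of_disjoint]
  · congr 1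
    ext t
    have : s < t → f t ≠ f s := fun h => hf.ne h.ne'
    simp
    grind
  · rw [disjoint_filter]
    grind

lemma lehmerCode_le {n : ℕ} (hf : f.Injective) (hn : ∀ s, f s ≤ n) (s : Fin k) :
    lehmerCode f s + (k - 1 - s) ≤ n := by
  have h : #{t | s < t ∧ f s < f t} ≤ n - f s := by
    rw [← Nat.card_Ioc]
    refine card_le_card_of_injOn f (fun t ht => ?_) hf.injOn
    simp_all
  have := lehmerCode_add_card hf s
  have := card_smaller_right_add_card hf s
  have := hn s
  omega

lemma le_lehmerCode_add (hf : f.Injective) (s : Fin k) : f s ≤ lehmerCode f s + (k - 1 - s) := by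
  have := lehmerCode_add_card hf s
  have := card_smaller_right_add_card hf s
  omega

end LehmerCode

lemma exists_strictMono_comp_perm {k : ℕ} {f : Fin k → ℕ} (hf : f.Injective) :
    ∃ (i : Fin k → ℕ) (σ : Equiv.Perm (Fin k)), StrictMono i ∧ i ∘ σ = f :=
  ⟨f ∘ Tuple.sort f, (Tuple.sort f)⁻¹,
    (Tuple.monotone_sort f).strictMono_of_injective (hf.comp (Tuple.sort f).injective), by
      ext s; simp⟩

lemma strictMono_comp_perm_inj {k : ℕ} {i i' : Fin k → ℕ} {σ σ' : Equiv.Perm (Fin k)}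
    (hi : StrictMono i) (hi' : StrictMono i') (h : i ∘ σ = i' ∘ σ') : i = i' ∧ σ = σ' := by
  have hii : i = i' := by
    rw [← hi.range_inj hi', ← σ.surjective.range_comp i, h, σ'.surjective.range_comp]
  subst hii
  exact ⟨rfl, Equiv.ext fun s => hi.injective (congrFun h s)⟩

lemma sign_eq_neg_one_pow_sum_alphaC {k : ℕ} {i : Fin k → ℕ} (hi : StrictMono i)
    (σ : Equiv.Perm (Fin k)) : (σ.sign : ℤ) = (-1) ^ ∑ s, alphaC i σ s := by
  rw [Equiv.Perm.sign_eq_prod_prod_Ioi, ← prod_pow_eq_pow_sum]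
  push_cast
  refine prod_congr rfl fun s _ => ?_
  rw [alphaC, ← prod_const]
  simp only [hi.lt_iff_lt]
  have h : ({t | s < t ∧ σ t < σ s} : Finset (Fin k)) = {t ∈ Ioi s | σ t < σ s} := by
    ext t
    simp
  rw [h, prod_filter]
  refine prod_congr rfl fun t ht => ?_
  have hne : σ t ≠ σ s := σ.injective.ne (mem_Ioi.1 ht).ne'
  rcases hne.lt_or_gt with hlt | hlt <;> simp [hlt, hlt.not_gt]

lemma neg_one_pow_sum_mul_sign {k : ℕ} {i : Fin k → ℕ} (hi : StrictMono i)
    (σ : Equiv.Perm (Fin k)) :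
    (-1) ^ (∑ s, i s) * (σ.sign : ℤ) = (-1) ^ ∑ s, hatC i σ s := by
  have h : ∑ s, i s = ∑ s, hatC i σ s + ∑ s, alphaC i σ s := by
    rw [← Equiv.sum_comp σ, ← sum_add_distrib]
    exact sum_congr rfl fun s _ =>
      (lehmerCode_add_card (hi.injective.comp σ.injective) s).symm
  rw [sign_eq_neg_one_pow_sum_alphaC hi, h, pow_add, mul_assoc, ← pow_add, Even.neg_one_pow ⟨_, rfl⟩,
    mul_one]

lemma sum_blocks {k : ℕ} (i : Fin k → ℕ) (σ : Equiv.Perm (Fin k)) (m : ℕ) (hm : m ≤ k) :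
    ∑ s, headBlock i σ m hm s + ∑ s, tailBlock i σ m s = ∑ s, hatC i σ s := by
  obtain ⟨l, rfl⟩ := Nat.exists_eq_add_of_le hm
  rw [Fin.sum_univ_add]
  congr 1
  rw [← Equiv.sum_comp (finCongr (Nat.add_sub_cancel_left (n := m) (m := l)).symm)]
  rfl

lemma hatC_eq_of_blocks_eq {k m : ℕ} (hm : m ≤ k) {i i' : Fin k → ℕ} {σ σ' : Equiv.Perm (Fin k)}
    (hhead : headBlock i σ m hm = headBlock i' σ' m hm)
    (htail : tailBlock i σ m = tailBlock i' σ' m) : hatC i σ = hatC i' σ' := by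
  ext s
  by_cases hs : s.1 < m
  · exact congrFun hhead ⟨s, hs⟩
  · have h := congrFun htail ⟨s - m, by omega⟩
    have hms : m + (s.1 - m) = s := by omega
    simpa only [tailBlock, hms] using h

lemma StrictMono.add_le_of_forall_le {m N : ℕ} {a : Fin m → ℕ} (ha : StrictMono a)
    (hN : ∀ s, a s ≤ N) (s : Fin m) : a s + (m - 1 - s) ≤ N := by
  have key : ∀ l (h : s.1 + l < m), a s + l ≤ a ⟨s + l, h⟩ := by
    intro l
    induction l with
    | zero => intro h; rfl
    | succ l ih =>
      intro h
      have h₁ := ih (by omega)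
      have h₂ : a ⟨s + l, by omega⟩ < a ⟨s + (l + 1), h⟩ := ha (Fin.mk_lt_mk.2 (by omega))
      omega
  exact (key (m - 1 - s) (by omega)).trans (hN _)

/-- Every pair of strictly increasing tuples is the pair of hatted blocks of some
strictly increasing tuple and some permutation. -/
lemma exists_blocks_eq {k m n : ℕ} (hm : m ≤ k) (hk : k ≤ n) {a : Fin m → ℕ} {b : Fin (k - m) → ℕ}
    (ha : StrictMono a) (hb : StrictMono b) (han : ∀ s, a s ≤ n - (k - m)) (hbn : ∀ s, b s ≤ n) :
    ∃ (i : Fin k → ℕ) (σ : Equiv.Perm (Fin k)), StrictMono i ∧ (∀ s, i s ≤ n) ∧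
      headBlock i σ m hm = a ∧ tailBlock i σ m = b := by
  obtain ⟨f, hf, hfg⟩ := exists_lehmerCode_eq fun s : Fin k =>
    if h : s.1 < m then a ⟨s, h⟩ else b ⟨s - m, by omega⟩
  obtain ⟨i, σ, hi, rfl⟩ := exists_strictMono_comp_perm hf
  refine ⟨i, σ, hi, fun s => ?_, funext fun s => ?_, funext fun s => ?_⟩
  · have h := le_lehmerCode_add hf (σ.symm s)
    rw [Function.comp_apply, σ.apply_symm_apply, hfg] at h
    generalize σ.symm s = t at h
    refine h.trans ?_
    dsimp only
    split_ifs with ht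
    · have := ha.add_le_of_forall_le han ⟨t, ht⟩
      dsimp only at this
      omega
    · have := hb.add_le_of_forall_le hbn ⟨t - m, by omega⟩
      dsimp only at this
      omega
  · rw [headBlock, hatC_eq_lehmerCode, hfg]
    simp
  · rw [tailBlock, hatC_eq_lehmerCode, hfg]
    simp

lemma headBlock_le {k m n : ℕ} (hm : m ≤ k) {i : Fin k → ℕ} (hi : StrictMono i)
    (hn : ∀ s, i s ≤ n) (σ : Equiv.Perm (Fin k)) (s : Fin m) :
    headBlock i σ m hm s ≤ n - (k - m) := by
  have h := lehmerCode_le (hi.injective.comp σ.injective) (fun s => hn (σ s)) (Fin.castLE hm s)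
  rw [headBlock, hatC_eq_lehmerCode]
  rw [Fin.val_castLE] at h
  omega

lemma tailBlock_le {k m n : ℕ} {i : Fin k → ℕ} (hn : ∀ s, i s ≤ n) (σ : Equiv.Perm (Fin k))
    (s : Fin (k - m)) : tailBlock i σ m s ≤ n :=
  (Nat.sub_le _ _).trans (hn _)

/-- Reindexing a signed sum over strictly increasing tuples and permutations by the pairs of
hatted blocks. -/
lemma sum_blocks_eq_sum_pairs {M : Type*} [AddCommGroup M] {k m n : ℕ} (hm : m ≤ k) (hk : k ≤ n)
    (T : (Fin m → ℕ) → (Fin (k - m) → ℕ) → M) :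
    (∑ i : Fin k → Fin (n + 1), if StrictMono (fun s => (i s : ℕ)) then
      ∑ σ : Equiv.Perm (Fin k),
        if StrictMono (headBlock (fun s => (i s : ℕ)) σ m hm) ∧
            StrictMono (tailBlock (fun s => (i s : ℕ)) σ m) then
          ((-1 : ℤ) ^ (∑ s, (i s : ℕ)) * (σ.sign : ℤ)) •
            T (headBlock (fun s => (i s : ℕ)) σ m hm) (tailBlock (fun s => (i s : ℕ)) σ m)
        else 0
      else 0) =
    ∑ a : Fin m → Fin (n - (k - m) + 1), ∑ b : Fin (k - m) → Fin (n + 1),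
      if StrictMono (fun s => (a s : ℕ)) ∧ StrictMono (fun s => (b s : ℕ)) then
        ((-1 : ℤ) ^ (∑ s, (a s : ℕ)) * (-1 : ℤ) ^ (∑ s, (b s : ℕ))) •
          T (fun s => (a s : ℕ)) (fun s => (b s : ℕ))
      else 0 := by
  simp only [ite_sum_zero, ← ite_and]
  rw [← Fintype.sum_prod_type', ← Fintype.sum_prod_type', ← sum_filter, ← sum_filter]
  refine sum_bij
    (fun p hp => (fun s => ⟨headBlock (fun s => (p.1 s : ℕ)) p.2 m hm s,
        Nat.lt_succ_of_le (headBlock_le hm (mem_filter.1 hp).2.1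
          (fun s => Nat.le_of_lt_succ (p.1 s).2) p.2 s)⟩,
      fun s => ⟨tailBlock (fun s => (p.1 s : ℕ)) p.2 m s,
        Nat.lt_succ_of_le (tailBlock_le (fun s => Nat.le_of_lt_succ (p.1 s).2) p.2 s)⟩))
    ?_ ?_ ?_ ?_
  · intro p hp
    simpa using (mem_filter.1 hp).2.2
  · rintro ⟨i, σ⟩ hp ⟨i', σ'⟩ hp' h
    have hi := (mem_filter.1 hp).2.1
    have hi' := (mem_filter.1 hp').2.1
    simp only [Prod.mk.injEq, funext_iff, Fin.mk.injEq] at h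
    have hhat := hatC_eq_of_blocks_eq hm (funext h.1) (funext h.2)
    rw [hatC_eq_lehmerCode, hatC_eq_lehmerCode] at hhat
    have := lehmerCode_injOn (hi.injective.comp σ.injective) (hi'.injective.comp σ'.injective) hhat
    obtain ⟨h₁, rfl⟩ := strictMono_comp_perm_inj hi hi' this
    simp only [Prod.mk.injEq, and_true]
    exact funext fun s => Fin.ext (congrFun h₁ s)
  · rintro ⟨a, b⟩ hab
    have hab := (mem_filter.1 hab).2
    obtain ⟨i, σ, hi, hin, hhead, htail⟩ := exists_blocks_eq hm hk hab.1 hab.2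
      (fun s => Nat.le_of_lt_succ (a s).2) (fun s => Nat.le_of_lt_succ (b s).2)
    refine ⟨(fun s => ⟨i s, Nat.lt_succ_of_le (hin s)⟩, σ), ?_, ?_⟩
    · simp only [mem_filter, mem_univ, true_and]
      exact ⟨hi, hhead ▸ hab.1, htail ▸ hab.2⟩
    · simp only [Prod.mk.injEq]
      exact ⟨funext fun s => Fin.ext (congrFun hhead s), funext fun s => Fin.ext (congrFun htail s)⟩
  · rintro ⟨i, σ⟩ hp
    have hi := (mem_filter.1 hp).2.1
    dsimp only at hi ⊢
    rw [neg_one_pow_sum_mul_sign hi, ← sum_blocks _ σ m hm, pow_add]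

section Faces

variable {K : Type} [CommRing K] {X : ℕ → ℤ → Type} [∀ n q, AddCommGroup (X n q)]
  [∀ n q, Module K (X n q)]

lemma gcast_gcast {n n' n'' : ℕ} {q q' q'' : ℤ} (hn : n = n') (hq : q = q') (hn' : n' = n'')
    (hq' : q' = q'') (x : X n q) :
    gcast (K := K) hn' hq' (gcast (K := K) hn hq x) =
      gcast (K := K) (hn.trans hn') (hq.trans hq') x := by
  subst hn hq hn' hq'
  rfl

variable (d : ∀ (n : ℕ) (q : ℤ), X n q →ₗ[K] X n (q - 1))
  (F : ∀ (k : ℕ), (Fin k → ℕ) → ∀ (n : ℕ) (q : ℤ), X n q →ₗ[K] X (n - k) (q + k - 1))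

/-- The graded commutator of the differential with a face: the left side of the relations. -/
def faceBoundary (k : ℕ) (i : Fin k → ℕ) (n : ℕ) (q : ℤ) :
    X n q →ₗ[K] X (n - k) (q + k - 1 - 1) :=
  d (n - k) (q + k - 1) ∘ₗ F k i n q + gcast rfl (by ring) ∘ₗ F k i n (q - 1) ∘ₗ d n q

/-- The composite of two faces, of total length `k`, transported to degree `(n - k, q + k - 2)`. -/
def faceComp (F : ∀ (k : ℕ), (Fin k → ℕ) → ∀ (n : ℕ) (q : ℤ), X n q →ₗ[K] X (n - k) (q + k - 1))
    {a b k : ℕ} (h : a + b = k) {n : ℕ} {q : ℤ} (x : X n q) (u : Fin a → ℕ) (v : Fin b → ℕ) :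
    X (n - k) (q + k - 2) :=
  gcast (K := K) (by omega) (by omega) (F a u (n - b) (q + b - 1) (F b v n q x))

/-- The composite `d^a ∘ d^b`, `a + b = k`, transported to degree `(n - k, q + k - 2)`. -/
noncomputable def dkComp {a b k : ℕ} (h : a + b = k) {n : ℕ} {q : ℤ} (x : X n q) :
    X (n - k) (q + k - 2) :=
  gcast (K := K) (by omega) (by omega) (dkOp X d F a (n - b) (q + b - 1) (dkOp X d F b n q x))

lemma dkOp_zero_apply (n : ℕ) (q : ℤ) (x : X n q) :
    dkOp X d F 0 n q x = gcast (K := K) (by omega) (by push_cast; ring) (d n q x) := by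
  rw [dkOp, dif_pos rfl]
  rfl

lemma dkOp_of_lt {k n : ℕ} (h : n < k) (q : ℤ) : dkOp X d F k n q = 0 := by
  rw [dkOp, dif_neg (by omega), dif_pos h]

lemma dkOp_apply {k n : ℕ} (hk : k ≠ 0) (hkn : k ≤ n) (q : ℤ) (x : X n q) :
    dkOp X d F k n q x = ∑ i : Fin k → Fin (n + 1), if StrictMono (fun s => (i s : ℕ)) then
      ((-1 : ℤ) ^ (∑ s, (i s : ℕ))) • F k (fun s => (i s : ℕ)) n q x else 0 := by
  rw [dkOp, dif_neg hk, dif_neg hkn.not_gt, LinearMap.sum_apply]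
  refine sum_congr rfl fun i _ => ?_
  split_ifs <;> simp

lemma dkOp_gcast {k n n' : ℕ} {q q' : ℤ} (hn : n = n') (hq : q = q') (x : X n q) :
    dkOp X d F k n' q' (gcast (K := K) hn hq x) =
      gcast (K := K) (by rw [hn]) (by rw [hq]) (dkOp X d F k n q x) := by
  subst hn hq
  rfl

lemma d_gcast {n n' : ℕ} {q q' : ℤ} (hn : n = n') (hq : q = q') (x : X n q) :
    d n' q' (gcast (K := K) hn hq x) = gcast (K := K) hn (by rw [hq]) (d n q x) := by
  subst hn hq
  rfl

lemma dkComp_congr {a a' b b' k : ℕ} (h : a + b = k) (h' : a' + b' = k) (hb : b = b') {n : ℕ}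
    {q : ℤ} (x : X n q) : dkComp d F h x = dkComp d F h' x := by
  obtain rfl : a = a' := by omega
  subst hb
  rfl

lemma dkComp_of_lt {a b k : ℕ} (h : a + b = k) {n : ℕ} (hn : n < k) {q : ℤ} (x : X n q) :
    dkComp d F h x = 0 := by
  rw [dkComp]
  by_cases hb : n < b
  · simp [dkOp_of_lt d F hb]
  · simp [dkOp_of_lt d F (show n - b < a by omega)]

lemma dkComp_eq_sum {a b k : ℕ} (h : a + b = k) (ha : a ≠ 0) (hb : b ≠ 0) {n : ℕ} (hn : k ≤ n)
    {q : ℤ} (x : X n q) :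
    dkComp d F h x = ∑ u : Fin a → Fin (n - b + 1), ∑ v : Fin b → Fin (n + 1),
      if StrictMono (fun s => (u s : ℕ)) ∧ StrictMono (fun s => (v s : ℕ)) then
        ((-1 : ℤ) ^ (∑ s, (u s : ℕ)) * (-1 : ℤ) ^ (∑ s, (v s : ℕ))) •
          faceComp F h x (fun s => (u s : ℕ)) (fun s => (v s : ℕ))
      else 0 := by
  rw [dkComp, dkOp_apply d F ha (by omega), map_sum]
  refine sum_congr rfl fun u _ => ?_
  rw [dkOp_apply d F hb (by omega)]
  split_ifs with hu
  · rw [map_zsmul, map_sum, map_sum, smul_sum]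
    refine sum_congr rfl fun v _ => ?_
    by_cases hv : StrictMono (fun s => (v s : ℕ))
    · rw [if_pos hv, if_pos ⟨hu, hv⟩, map_zsmul, map_zsmul, smul_smul, faceComp]
    · rw [if_neg hv, if_neg fun h => hv h.2, map_zero, map_zero, smul_zero]
  · rw [map_zero]
    exact (sum_eq_zero fun v _ => if_neg fun h => hu h.1).symm

lemma dkComp_eq_sum_perm {m k : ℕ} (hm : 1 ≤ m) (hmk : m < k) {n : ℕ} (hn : k ≤ n) {q : ℤ}
    (x : X n q) :
    dkComp d F (Nat.add_sub_of_le hmk.le) x =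
      ∑ i : Fin k → Fin (n + 1), if StrictMono (fun s => (i s : ℕ)) then
        ∑ σ : Equiv.Perm (Fin k),
          if StrictMono (headBlock (fun s => (i s : ℕ)) σ m hmk.le) ∧
              StrictMono (tailBlock (fun s => (i s : ℕ)) σ m) then
            ((-1 : ℤ) ^ (∑ s, (i s : ℕ)) * (σ.sign : ℤ)) •
              faceComp F (Nat.add_sub_of_le hmk.le) x
                (headBlock (fun s => (i s : ℕ)) σ m hmk.le) (tailBlock (fun s => (i s : ℕ)) σ m)
          else 0
        else 0 := by
  rw [dkComp_eq_sum d F _ (by omega) (by omega) hn, ← sum_blocks_eq_sum_pairs hmk.le hn]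

lemma dkComp_zero_left_add_zero_right {k : ℕ} (hk : k ≠ 0) {n : ℕ} (hn : k ≤ n) {q : ℤ}
    (x : X n q) :
    dkComp d F (zero_add k) x + dkComp d F (add_zero k) x =
      ∑ i : Fin k → Fin (n + 1), if StrictMono (fun s => (i s : ℕ)) then
        ((-1 : ℤ) ^ (∑ s, (i s : ℕ))) •
          gcast (K := K) rfl (by ring) (faceBoundary d F k (fun s => (i s : ℕ)) n q x)
      else 0 := by
  rw [dkComp, dkComp, dkOp_zero_apply, dkOp_zero_apply, dkOp_gcast, gcast_gcast, gcast_gcast,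
    dkOp_apply d F hk hn, dkOp_apply d F hk hn, map_sum, map_sum, map_sum, ← sum_add_distrib]
  refine sum_congr rfl fun i _ => ?_
  split_ifs
  · simp only [faceBoundary, map_zsmul, LinearMap.add_apply, LinearMap.comp_apply, map_add, smul_add,
      gcast_gcast]
  · simp only [map_zero, add_zero]

variable {d F}

lemma Rel25.gcast_faceBoundary (hF : Rel25 X d F) {k : ℕ} (hk : k ≠ 0) {i : Fin k → ℕ}
    (hi : StrictMono i) {n : ℕ} (hn : ∀ s, i s ≤ n) {q : ℤ} (x : X n q) :
    gcast (K := K) (q' := q + k - 2) rfl (by ring) (faceBoundary d F k i n q x) =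
      -∑ m ∈ (Icc 1 (k - 1)).attach, ∑ σ : Equiv.Perm (Fin k),
        if StrictMono (headBlock i σ m.1 ((mem_Icc.mp m.2).2.trans (Nat.sub_le k 1))) ∧
            StrictMono (tailBlock i σ m.1) then
          (σ.sign : ℤ) • faceComp F
            (Nat.add_sub_of_le ((mem_Icc.mp m.2).2.trans (Nat.sub_le k 1))) x
            (headBlock i σ m.1 ((mem_Icc.mp m.2).2.trans (Nat.sub_le k 1))) (tailBlock i σ m.1)
        else 0 := by
  rw [faceBoundary, hF k (Nat.one_le_iff_ne_zero.2 hk) i hi n q (hn _), sum_comm, LinearMap.sum_apply, map_sum,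
    ← sum_neg_distrib]
  refine sum_congr rfl fun m _ => ?_
  rw [LinearMap.sum_apply, map_sum, ← sum_neg_distrib]
  refine sum_congr rfl fun σ _ => ?_
  split_ifs
  · rw [LinearMap.smul_apply, map_zsmul, LinearMap.comp_apply, gcast_gcast, neg_smul]
    rfl
  · simp

lemma sum_attach_range_eq {M : Type*} [AddCommMonoid M] {k : ℕ} (hk : k ≠ 0)
    (G : ∀ j, j ≤ k → M) :
    ∑ j ∈ (range (k + 1)).attach, G j.1 (Nat.le_of_lt_succ (mem_range.1 j.2)) =
      G k le_rfl + G 0 (Nat.zero_le k) +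
        ∑ m ∈ (Icc 1 (k - 1)).attach, G (k - m.1) (Nat.sub_le k m.1) := by
  have h₁ : ∑ j ∈ (range (k + 1)).attach, G j.1 (Nat.le_of_lt_succ (mem_range.1 j.2)) =
      ∑ j ∈ range (k + 1), if h : j ≤ k then G j h else 0 := by
    rw [← sum_attach (range (k + 1))]
    exact sum_congr rfl fun j _ => (dif_pos (Nat.le_of_lt_succ (mem_range.1 j.2))).symm
  rw [h₁, sum_attach (Icc 1 (k - 1)) fun m => G (k - m) (Nat.sub_le k m)]
  obtain ⟨l, rfl⟩ := Nat.exists_eq_succ_of_ne_zero hk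
  rw [sum_range_succ, sum_range_succ', dif_pos le_rfl, dif_pos (Nat.zero_le _), add_comm, add_assoc,
    add_comm (G 0 _)]
  congr 2
  refine sum_bij' (fun j _ => l - j) (fun m _ => l - m) ?_ ?_ ?_ ?_ ?_
  · intro j hj; simp at hj ⊢; omega
  · intro j hj; simp at hj ⊢; omega
  · intro j hj; simp at hj ⊢; omega
  · intro j hj; simp at hj ⊢; omega
  · intro j hj
    simp only [mem_range] at hj
    rw [dif_pos (by omega)]
    congr 1
    omega

lemma sum_dkComp_eq_zero (hd : ∀ (n : ℕ) (q : ℤ), d n (q - 1) ∘ₗ d n q = 0)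
    (hF : Rel25 X d F) (k : ℕ) {n : ℕ} {q : ℤ} (x : X n q) :
    ∑ j ∈ (range (k + 1)).attach,
      dkComp d F (Nat.sub_add_cancel (Nat.le_of_lt_succ (mem_range.1 j.2))) x = 0 := by
  rcases lt_or_ge n k with hn | hn
  · exact sum_eq_zero fun j _ => dkComp_of_lt d F _ hn x
  rcases eq_or_ne k 0 with rfl | hk
  · refine sum_eq_zero fun j _ => ?_
    rw [dkComp_congr d F _ (zero_add 0) (by have := mem_range.1 j.2; omega), dkComp,
      dkOp_zero_apply, dkOp_zero_apply, d_gcast, ← LinearMap.comp_apply (d _ _), hd]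
    simp
  rw [sum_attach_range_eq hk fun j hj => dkComp d F (Nat.sub_add_cancel hj) x,
    dkComp_congr d F _ (zero_add k) rfl, dkComp_congr d F _ (add_zero k) rfl,
    dkComp_zero_left_add_zero_right d F hk hn, add_eq_zero_iff_eq_neg]
  rw [sum_congr rfl fun m _ => (dkComp_congr d F _
      (Nat.add_sub_of_le ((mem_Icc.mp m.2).2.trans (Nat.sub_le k 1))) rfl x).trans
      (dkComp_eq_sum_perm d F (mem_Icc.mp m.2).1 (by have := mem_Icc.mp m.2; omega) hn x)]
  rw [sum_comm, ← sum_neg_distrib]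
  refine sum_congr rfl fun i _ => ?_
  by_cases hi : StrictMono fun s => (i s : ℕ)
  · simp only [if_pos hi]
    rw [hF.gcast_faceBoundary hk hi (fun s => Nat.le_of_lt_succ (i s).2), smul_neg, smul_sum]
    simp only [smul_sum, smul_ite, smul_zero, smul_smul]
  · simp only [if_neg hi, sum_const_zero, neg_zero]

end Faces

end HattedBlocks

/-- For a differential module with ∞-simplicial faces `(X,d,∂̃)`, the maps
`d^k` of (3.7) satisfy `Σ_{i+j=k} d^i ∘ d^j = 0` for every `k ≥ 0`; that is, `(X,{d^k})` is
a D∞-module. -/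
theorem faces_give_DInfty {K : Type} [CommRing K] (X : ℕ → ℤ → Type)
    [∀ n q, AddCommGroup (X n q)] [∀ n q, Module K (X n q)]
    (d : ∀ (n : ℕ) (q : ℤ), X n q →ₗ[K] X n (q - 1))
    (hd : ∀ (n : ℕ) (q : ℤ), d n (q - 1) ∘ₗ d n q = 0)
    (F : ∀ (k : ℕ), (Fin k → ℕ) → ∀ (n : ℕ) (q : ℤ), X n q →ₗ[K] X (n - k) (q + k - 1))
    (hF : Rel25 X d F) :
    ∀ (k n : ℕ) (q : ℤ),
      (∑ j ∈ (Finset.range (k + 1)).attach,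
          gcast (by have h := Finset.mem_range.mp j.2; omega)
              (by have h := Finset.mem_range.mp j.2; omega) ∘ₗ
            dkOp X d F (k - j.1) (n - j.1) (q + j.1 - 1) ∘ₗ dkOp X d F j.1 n q)
        = (0 : X n q →ₗ[K] X (n - k) (q + k - 2)) := by
  intro k n q
  refine LinearMap.ext fun x => ?_
  rw [LinearMap.sum_apply]
  exact sum_dkComp_eq_zero hd hF k x
end

section
/- Let (i_1,…,i_k) be a strictly increasing tuple of nonnegative integers with maximal element q = i_k, let σ ∈ Σ_k be a permutation of its positions and 1 ≤ m ≤ k−1. Suppose q belongs to the head block values {σ(i_1),…,σ(i_m)} and the hatted head block is strictly increasing: ĥσ(i_1) < … < ĥσ(i_m). Then ĥσ(i_m) = q − (k−m). -/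
/-- A descent between adjacent positions forces a weak descent between the hatted entries. -/
theorem hatC_le_hatC_of_descent {k : ℕ} {i : Fin k → ℕ} (hi : Function.Injective i)
    (σ : Equiv.Perm (Fin k)) {s t : Fin k} (hst : t.1 = s.1 + 1) (h : i (σ t) < i (σ s)) :
    hatC i σ t ≤ hatC i σ s := by
  have hsub : (Finset.univ.filter fun u => s < u ∧ i (σ u) < i (σ s)) ⊆
      insert t ((Finset.univ.filter fun u => t < u ∧ i (σ u) < i (σ t)) ∪
        (Finset.univ.filter fun u => i (σ u) ∈ Finset.Ioo (i (σ t)) (i (σ s)))) := by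
    intro u hu
    simp only [Finset.mem_filter, Finset.mem_univ, true_and, Finset.mem_insert,
      Finset.mem_union, Finset.mem_Ioo] at hu ⊢
    by_cases hut : u = t
    · exact Or.inl hut
    · have hne : i (σ u) ≠ i (σ t) := fun e => hut (σ.injective (hi e))
      have hut' : u.1 ≠ t.1 := fun e => hut (Fin.ext e)
      simp only [Fin.lt_def] at hu ⊢
      omega
  have hcard : (Finset.univ.filter fun u => i (σ u) ∈ Finset.Ioo (i (σ t)) (i (σ s))).card ≤
      (Finset.Ioo (i (σ t)) (i (σ s))).card :=
    Finset.card_le_card_of_injOn (fun u => i (σ u)) (fun u hu => by simpa using hu)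
      ((hi.comp σ.injective).injOn)
  have hle := (Finset.card_le_card hsub).trans
    ((Finset.card_insert_le _ _).trans (Nat.succ_le_succ (Finset.card_union_le _ _)))
  rw [Nat.card_Ioo] at hcard
  unfold hatC alphaC
  omega

/-- The position of the maximal entry contributes the number of all later positions. -/
theorem alphaC_of_forall_le {k : ℕ} {i : Fin k → ℕ} (hi : Function.Injective i)
    (σ : Equiv.Perm (Fin k)) {s : Fin k} (h : ∀ j, i j ≤ i (σ s)) :
    alphaC i σ s = k - 1 - s.1 := by
  have heq : (Finset.univ.filter fun u => s < u ∧ i (σ u) < i (σ s)) = Finset.Ioi s := by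
    ext u
    simp only [Finset.mem_filter, Finset.mem_univ, true_and, Finset.mem_Ioi,
      and_iff_left_iff_imp]
    exact fun hu => lt_of_le_of_ne (h _) fun e => hu.ne' (σ.injective (hi e))
  rw [alphaC, heq, Fin.card_Ioi]

/-- Let `(i_1,…,i_k)` be strictly increasing with maximal element
`q = i_k`, let `σ ∈ Σ_k` and `1 ≤ m ≤ k−1`.  If `q` occurs among the head block values
`{σ(i_1),…,σ(i_m)}` and the hatted head block `ĥσ(i_1) < … < ĥσ(i_m)` is strictly
increasing, then `ĥσ(i_m) = q − (k−m)`. -/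
theorem hatted_head_last_of_head {k : ℕ} (hk : 1 ≤ k) (i : Fin k → ℕ) (hi : StrictMono i)
    (σ : Equiv.Perm (Fin k)) (m : ℕ) (hm1 : 1 ≤ m) (hm2 : m ≤ k - 1)
    (hq : ∃ s : Fin k, s.1 < m ∧ i (σ s) = i ⟨k - 1, by omega⟩)
    (hmono : StrictMono fun s : Fin m => hatC i σ (Fin.castLE (by omega) s)) :
    (hatC i σ ⟨m - 1, by omega⟩ : ℤ) = (i ⟨k - 1, by omega⟩ : ℤ) - ((k : ℤ) - (m : ℤ)) := by
  obtain ⟨s, hs, hsq⟩ := hq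
  have hmax : ∀ j, i j ≤ i (σ s) := fun j => by
    rw [hsq]
    exact hi.monotone (Fin.le_def.2 (by have := j.2; simp only; omega))
  have hsm : s.1 = m - 1 := by
    by_contra hne
    let t : Fin k := ⟨s.1 + 1, by omega⟩
    have hlt : i (σ t) < i (σ s) := lt_of_le_of_ne (hmax _) fun e => by
      have := congrArg Fin.val (σ.injective (hi.injective e))
      simp [t] at this
    have hle := hatC_le_hatC_of_descent hi.injective σ (s := s) (t := t) rfl hlt
    have hlt' := @hmono ⟨s.1, hs⟩ ⟨s.1 + 1, by omega⟩ (Fin.lt_def.2 (Nat.lt_succ_self _))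
    exact absurd hlt' (not_lt.2 hle)
  have hse : (⟨m - 1, by omega⟩ : Fin k) = s := Fin.ext hsm.symm
  have hα := alphaC_of_forall_le hi.injective σ hmax
  have hk' : k - 1 ≤ i ⟨k - 1, by omega⟩ := by
    have hidx : ∀ n (hn : n < k), n ≤ i ⟨n, hn⟩ := by
      intro n
      induction n with
      | zero => exact fun _ => Nat.zero_le _
      | succ n ih =>
        intro hn
        exact (ih (by omega)).trans_lt (hi (Fin.lt_def.2 (Nat.lt_succ_self n)))
    exact hidx _ _
  rw [hse, hatC, hα]
  omega
end
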